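/- If T is a tree in 𝒯₃ with n ≥ 4 vertices and t twigs, then μ(T) < 3n/4 − 2t/5. -/

import Mathlib

open SimpleGraph Finset BigOperators Filter

attribute [local instance] Classical.propDecidable

/-- A finset of vertices induces a subtree of `G`: it is nonempty and its induced
subgraph is connected. -/
def SimpleGraph.IsSubtree {V : Type*} (G : SimpleGraph V) (s : Finset V) : Prop :=
  s.Nonempty ∧ (G.induce (s : Set V)).Connected

/-- The collection of all subtrees of `G` (as finsets of vertices). -/
noncomputable def subtreeFinset {V : Type*} [Fintype V] (G : SimpleGraph V) :
    Finset (Finset V) :=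
  Finset.univ.filter G.IsSubtree

/-- `μ(G)`: the average order (number of vertices) of a subtree of `G`. -/
noncomputable def mu {V : Type*} [Fintype V] (G : SimpleGraph V) : ℚ :=
  (∑ s ∈ subtreeFinset G, (s.card : ℚ)) / ((subtreeFinset G).card : ℚ)

/-- `G` is in the class 𝒯₃: a tree with at least one internal vertex (a vertex of
degree at least 2) in which every internal vertex has degree at least 3. -/
noncomputable def InT3 {V : Type*} [Fintype V] (G : SimpleGraph V) : Prop :=
  G.IsTree ∧ (∃ v, 2 ≤ G.degree v) ∧ ∀ v, 2 ≤ G.degree v → 3 ≤ G.degree v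

/-- `v` is a twig of `G`: it has degree at least 2 and at least `deg(v) - 1` of its
neighbours are leaves. -/
noncomputable def IsTwig {V : Type*} [Fintype V] (G : SimpleGraph V) (v : V) : Prop :=
  2 ≤ G.degree v ∧
    G.degree v - 1 ≤ ((G.neighborFinset v).filter (fun u => G.degree u = 1)).card

/-- The number of twigs of `G`. -/
noncomputable def numTwigs {V : Type*} [Fintype V] (G : SimpleGraph V) : ℕ :=
  (Finset.univ.filter (fun v => IsTwig G v)).card

namespace SimpleGraph

variable {V : Type*} {G : SimpleGraph V}

/-- Deleting vertices that have at most one neighbour in a subtree leaves a subtree. -/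
lemma IsSubtree.sdiff {s D : Finset V} (hs : G.IsSubtree s) (hne : (s \ D).Nonempty)
    (hD : ∀ x ∈ s, x ∈ D → ∀ a ∈ s, ∀ b ∈ s, G.Adj x a → G.Adj x b → a = b) :
    G.IsSubtree (s \ D) := by
  refine ⟨hne, ?_⟩
  have hpre : ((G.induce (s : Set V)).induce {x | x.1 ∉ D}).Preconnected := by
    refine hs.2.preconnected.induce_of_degree_eq_one fun x hx a ha b hb => Subtype.ext ?_
    exact hD x x.2 (by simpa using hx) a a.2 b b.2 (by simpa using ha) (by simpa using hb)
  have hcon : ((G.induce (s : Set V)).induce {x | x.1 ∉ D}).Connected := by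
    obtain ⟨y, hy⟩ := hne
    rw [Finset.mem_sdiff] at hy
    exact (connected_iff _).2 ⟨hpre, ⟨⟨⟨y, hy.1⟩, hy.2⟩⟩⟩
  refine hcon.map (H := G.induce ((s \ D : Finset V) : Set V))
    ⟨fun a => ⟨a.1.1, Finset.mem_coe.2 (Finset.mem_sdiff.2 ⟨a.1.2, a.2⟩)⟩, fun h => h⟩ ?_
  rintro ⟨y, hy⟩
  rw [Finset.mem_coe, Finset.mem_sdiff] at hy
  exact ⟨⟨⟨y, hy.1⟩, hy.2⟩, rfl⟩

/-- A vertex of a subtree that is not alone has a neighbour in it. -/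
lemma IsSubtree.exists_adj {s : Finset V} (hs : G.IsSubtree s) {x y : V} (hx : x ∈ s)
    (hy : y ∈ s) (hxy : x ≠ y) : ∃ z ∈ s, G.Adj x z := by
  have : Nontrivial (s : Set V) := ⟨⟨x, hx⟩, ⟨y, hy⟩, by simpa using hxy⟩
  obtain ⟨z, hz⟩ := hs.2.preconnected.exists_adj_of_nontrivial ⟨x, hx⟩
  exact ⟨z, z.2, by simpa using hz⟩

lemma isSubtree_singleton (v : V) : G.IsSubtree {v} := by
  refine ⟨by simp, ?_⟩
  rw [Finset.coe_singleton]
  have : Subsingleton ({v} : Set V) := by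
    rw [Set.subsingleton_coe]
    exact Set.subsingleton_singleton
  exact (connected_iff _).2 ⟨Preconnected.of_subsingleton, ⟨⟨v, rfl⟩⟩⟩

lemma isSubtree_pair {u v : V} (h : G.Adj u v) : G.IsSubtree {u, v} := by
  refine ⟨by simp, ?_⟩
  rw [Finset.coe_pair]
  exact induce_pair_connected_of_adj h

/-- Two adjacent leaves are the only vertices of a connected graph. -/
lemma Connected.card_le_two [Fintype V] (hG : G.Connected) {x y : V} (hxy : G.Adj x y)
    (hx : G.degree x = 1) (hy : G.degree y = 1) : Fintype.card V ≤ 2 := by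
  rw [degree_eq_one_iff_existsUnique_adj] at hx hy
  have key : ∀ z, z = x ∨ z = y := by
    intro z
    obtain ⟨p⟩ := hG.preconnected z x
    induction p with
    | nil => exact Or.inl rfl
    | @cons a b c hab p ih =>
      rcases ih hxy hx with rfl | rfl
      · exact Or.inr (hx.unique hab.symm hxy)
      · exact Or.inl (hy.unique hab.symm hxy.symm)
  calc Fintype.card V = (Finset.univ : Finset V).card := rfl
    _ ≤ ({x, y} : Finset V).card := Finset.card_le_card fun z _ => by simpa using key z
    _ ≤ 2 := Finset.card_le_two

end SimpleGraph

section Counting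

variable {V : Type*} [Fintype V] {G : SimpleGraph V}

lemma mem_subtreeFinset {s : Finset V} : s ∈ subtreeFinset G ↔ G.IsSubtree s := by
  simp [subtreeFinset]

/-- The number of subtrees containing `v`. -/
noncomputable def numSubtreesAt (G : SimpleGraph V) (v : V) : ℕ :=
  ((subtreeFinset G).filter (fun s => v ∈ s)).card

lemma sum_card_subtrees (G : SimpleGraph V) :
    ∑ s ∈ subtreeFinset G, s.card = ∑ v, numSubtreesAt G v := by
  have h := Finset.sum_card_bipartiteAbove_eq_sum_card_bipartiteBelow
    (s := subtreeFinset G) (t := (Finset.univ : Finset V)) (fun s v => v ∈ s)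
  simpa [Finset.bipartiteAbove, Finset.bipartiteBelow, numSubtreesAt] using h

/-- A leaf lies in at most half of the subtrees containing its neighbour, and in one more. -/
lemma numSubtreesAt_leaf {x y : V} (hx : G.degree x = 1) (hxy : G.Adj x y) :
    2 * numSubtreesAt G x ≤ 2 + numSubtreesAt G y := by
  have huniq : ∀ z, G.Adj x z → z = y := fun z hz =>
    (degree_eq_one_iff_existsUnique_adj.1 hx).unique hz hxy
  set A := (subtreeFinset G).filter (fun s => x ∈ s ∧ y ∈ s) with hA
  set B := (subtreeFinset G).filter (fun s => x ∉ s ∧ y ∈ s) with hB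
  have h1 : numSubtreesAt G x ≤ 1 + A.card := by
    calc numSubtreesAt G x ≤ ({{x}} ∪ A).card := by
          refine Finset.card_le_card fun s hs => ?_
          rw [Finset.mem_filter, mem_subtreeFinset] at hs
          rw [Finset.mem_union, Finset.mem_singleton, hA, Finset.mem_filter, mem_subtreeFinset]
          by_cases h : ∃ z ∈ s, x ≠ z
          · obtain ⟨z, hz, hxz⟩ := h
            obtain ⟨w, hw, hxw⟩ := hs.1.exists_adj hs.2 hz hxz
            exact Or.inr ⟨hs.1, hs.2, huniq w hxw ▸ hw⟩
          · push Not at h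
            exact Or.inl (Finset.eq_singleton_iff_unique_mem.2 ⟨hs.2, fun z hz => (h z hz).symm⟩)
      _ ≤ 1 + A.card := (Finset.card_union_le _ _).trans (by simp)
  have h2 : A.card ≤ B.card := by
    refine Finset.card_le_card_of_injOn (fun s => s \ {x}) ?_ ?_
    · intro s hs
      rw [Finset.mem_coe, hA, Finset.mem_filter, mem_subtreeFinset] at hs
      rw [Finset.mem_coe, hB, Finset.mem_filter, mem_subtreeFinset]
      have hy : y ∈ s \ {x} := by simpa using ⟨hs.2.2, hxy.ne'⟩
      refine ⟨hs.1.sdiff ⟨y, hy⟩ ?_, by simp, hy⟩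
      intro z _ hz a _ b _ hza hzb
      rw [Finset.mem_singleton] at hz
      subst hz
      rw [huniq a hza, huniq b hzb]
    · intro s hs t ht hst
      rw [Finset.mem_coe, hA, Finset.mem_filter] at hs ht
      have hst : s \ {x} = t \ {x} := hst
      rw [← Finset.sdiff_union_of_subset (Finset.singleton_subset_iff.2 hs.2.1), hst,
        Finset.sdiff_union_of_subset (Finset.singleton_subset_iff.2 ht.2.1)]
  have h3 : A.card + B.card = numSubtreesAt G y := by
    rw [numSubtreesAt, ← Finset.card_filter_add_card_filter_not
      (s := (subtreeFinset G).filter (fun s => y ∈ s)) (fun s => x ∈ s),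
      Finset.filter_filter, Finset.filter_filter, hA, hB]
    simp only [and_comm]
  omega

/-- If all neighbours of `v` but one are leaves, then the subtrees avoiding `v` are not too
rare. -/
lemma numSubtreesAt_le_of_leaves {v u : V} {D : Finset V} (hne : D.Nonempty)
    (hD : ∀ x ∈ D, G.Adj v x ∧ G.degree x = 1) (hu : ∀ z, G.Adj v z → z ∈ D ∨ z = u) :
    numSubtreesAt G v ≤
      2 ^ D.card * ((subtreeFinset G).filter (fun s => v ∉ s)).card := by
  obtain ⟨x₀, hx₀⟩ := hne
  have hvD : v ∉ D := fun h => (hD v h).1.ne rfl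
  have huniq : ∀ x ∈ D, ∀ z, G.Adj x z → z = v := fun x hx z hz =>
    (degree_eq_one_iff_existsUnique_adj.1 (hD x hx).2).unique hz (hD x hx).1.symm
  let r : Finset V → Finset V := fun s =>
    if ((s \ D) \ {v}).Nonempty then (s \ D) \ {v} else {x₀}
  rw [numSubtreesAt, ← Finset.card_powerset, ← Finset.card_product]
  refine Finset.card_le_card_of_injOn (fun s => (s ∩ D, r s)) ?_ ?_
  · intro s hs
    rw [Finset.mem_coe, Finset.mem_filter, mem_subtreeFinset] at hs
    rw [Finset.mem_coe, Finset.mem_product, Finset.mem_powerset, Finset.mem_filter,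
      mem_subtreeFinset]
    refine ⟨Finset.inter_subset_right, ?_⟩
    by_cases h : ((s \ D) \ {v}).Nonempty
    · simp only [r, if_pos h]
      have hsD : G.IsSubtree (s \ D) := by
        refine hs.1.sdiff ⟨v, by simpa using ⟨hs.2, hvD⟩⟩ ?_
        intro x _ hx a _ b _ ha hb
        rw [huniq x hx a ha, huniq x hx b hb]
      refine ⟨hsD.sdiff h ?_, by simp⟩
      intro z _ hz a ha b hb hza hzb
      rw [Finset.mem_singleton] at hz
      subst hz
      rw [Finset.mem_sdiff] at ha hb
      rw [(hu a hza).resolve_left ha.2, (hu b hzb).resolve_left hb.2]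
    · simp only [r, if_neg h]
      refine ⟨isSubtree_singleton x₀, ?_⟩
      rw [Finset.mem_singleton]
      rintro rfl
      exact hvD hx₀
  · intro s hs t ht hst
    rw [Finset.mem_coe, Finset.mem_filter] at hs ht
    simp only [Prod.mk.injEq] at hst
    obtain ⟨h1, h2⟩ := hst
    have key : (s \ D) \ {v} = (t \ D) \ {v} := by
      by_cases h : ((s \ D) \ {v}).Nonempty <;> by_cases h' : ((t \ D) \ {v}).Nonempty
      · simpa only [r, if_pos h, if_pos h'] using h2
      · simp only [r, if_pos h, if_neg h'] at h2
        have : x₀ ∈ (s \ D) \ {v} := by rw [h2]; simp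
        simp [hx₀] at this
      · simp only [r, if_neg h, if_pos h'] at h2
        have : x₀ ∈ (t \ D) \ {v} := by rw [← h2]; simp
        simp [hx₀] at this
      · rw [Finset.not_nonempty_iff_eq_empty.1 h, Finset.not_nonempty_iff_eq_empty.1 h']
    ext z
    have e1 : z ∈ s ∩ D ↔ z ∈ t ∩ D := by rw [h1]
    have e2 : z ∈ (s \ D) \ {v} ↔ z ∈ (t \ D) \ {v} := by rw [key]
    simp only [Finset.mem_inter, Finset.mem_sdiff, Finset.mem_singleton] at e1 e2
    by_cases hzv : z = v
    · subst hzv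
      exact iff_of_true hs.2 ht.2
    · tauto

/-- Single vertices and edges are subtrees. -/
lemma card_add_card_edgeFinset_le (G : SimpleGraph V) :
    Fintype.card V + G.edgeFinset.card ≤ (subtreeFinset G).card := by
  set A := (Finset.univ : Finset V).image (fun v => ({v} : Finset V)) with hA
  set B := G.edgeFinset.image (fun e => e.toFinset) with hB
  have hAc : A.card = Fintype.card V :=
    Finset.card_image_of_injective _ Finset.singleton_injective
  have hBc : B.card = G.edgeFinset.card := by
    refine Finset.card_image_of_injective _ fun e f h => Sym2.ext fun x => ?_
    have h : e.toFinset = f.toFinset := h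
    rw [← Sym2.mem_toFinset, h, Sym2.mem_toFinset]
  have hdisj : Disjoint A B := by
    rw [Finset.disjoint_left]
    intro s hsA hsB
    rw [hA, Finset.mem_image] at hsA
    rw [hB, Finset.mem_image] at hsB
    obtain ⟨v, -, rfl⟩ := hsA
    obtain ⟨e, he, hev⟩ := hsB
    have := card_toFinset_mem_edgeFinset (G := G) ⟨e, he⟩
    rw [hev, Finset.card_singleton] at this
    omega
  rw [← hAc, ← hBc, ← Finset.card_union_of_disjoint hdisj]
  refine Finset.card_le_card fun s hs => ?_
  rw [mem_subtreeFinset]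
  rcases Finset.mem_union.1 hs with h | h
  · obtain ⟨v, -, rfl⟩ := Finset.mem_image.1 h
    exact isSubtree_singleton v
  · obtain ⟨e, he, rfl⟩ := Finset.mem_image.1 h
    induction e with
    | _ a b =>
      rw [Sym2.toFinset_mk_eq]
      exact isSubtree_pair (by simpa using he)

/-- The number of leaves adjacent to `v`. -/
noncomputable def numLeavesAt (G : SimpleGraph V) (v : V) : ℕ :=
  ((G.neighborFinset v).filter (fun u => G.degree u = 1)).card

/-- The number of subtrees containing a twig, weighted by the number of leaves at the twig. -/
lemma numSubtreesAt_twig {v : V} (hv : IsTwig G v) (hdeg : 3 ≤ G.degree v) :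
    (numSubtreesAt G v : ℚ) * (1 + (numLeavesAt G v : ℚ) / 2) ≤
      ((subtreeFinset G).card : ℚ) *
        (1 + (numLeavesAt G v : ℚ) / 2 + ((G.degree v : ℚ) - 3) / 4 - 2 / 5) := by
  obtain ⟨D, hDsub, hDcard⟩ := Finset.exists_subset_card_eq hv.2
  have hDleaf : ∀ x ∈ D, G.Adj v x ∧ G.degree x = 1 := fun x hx => by
    simpa using hDsub hx
  have hDne : D.Nonempty := Finset.card_pos.1 (by omega)
  have hDnbr : D ⊆ G.neighborFinset v := hDsub.trans (Finset.filter_subset _ _)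
  have hrest : (G.neighborFinset v \ D).card = 1 := by
    rw [Finset.card_sdiff_of_subset hDnbr, card_neighborFinset_eq_degree]
    omega
  obtain ⟨u, hu⟩ := Finset.card_eq_one.1 hrest
  have hnbr : ∀ z, G.Adj v z → z ∈ D ∨ z = u := fun z hz => by
    by_cases hzD : z ∈ D
    · exact Or.inl hzD
    · refine Or.inr ?_
      rw [← Finset.mem_singleton, ← hu, Finset.mem_sdiff]
      exact ⟨by simpa using hz, hzD⟩
  have hin := numSubtreesAt_le_of_leaves hDne hDleaf hnbr
  have hl : G.degree v - 1 ≤ numLeavesAt G v := hv.2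
  have htot : numSubtreesAt G v + ((subtreeFinset G).filter (fun s => v ∉ s)).card =
      (subtreeFinset G).card :=
    Finset.card_filter_add_card_filter_not (fun s => v ∈ s)
  obtain ⟨d, hd⟩ : ∃ d, G.degree v = d + 1 := ⟨G.degree v - 1, by omega⟩
  rw [hDcard] at hin
  rw [hd, Nat.add_sub_cancel] at hin hl
  rw [hd] at hdeg ⊢
  generalize numLeavesAt G v = l at *
  generalize ((subtreeFinset G).filter (fun s => v ∉ s)).card = o at *
  rw [← htot]
  generalize numSubtreesAt G v = c at *
  have hlq : (d : ℚ) ≤ l := by exact_mod_cast hl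
  have hc : (0 : ℚ) ≤ c := by positivity
  have ho : (0 : ℚ) ≤ o := by positivity
  have hol : (o : ℚ) * d ≤ o * l := mul_le_mul_of_nonneg_left hlq ho
  push_cast
  have hd2 : d = 2 ∨ d = 3 ∨ 4 ≤ d := by omega
  rcases hd2 with rfl | rfl | hd4
  · have hin : (c : ℚ) ≤ 4 * o := by exact_mod_cast hin
    norm_num at hol ⊢
    nlinarith
  · have hin : (c : ℚ) ≤ 8 * o := by exact_mod_cast hin
    norm_num at hol ⊢
    nlinarith
  · have hd4 : (4 : ℚ) ≤ d := by exact_mod_cast hd4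
    have hod : (o : ℚ) * 4 ≤ o * d := mul_le_mul_of_nonneg_left hd4 ho
    have hcd : (c : ℚ) * 4 ≤ c * d := mul_le_mul_of_nonneg_left hd4 hc
    nlinarith

/-- Summing over the leaves and their neighbours is summing over internal vertices, weighted by
the number of leaves at each. -/
lemma sum_leaf_neighbors (hG : G.Connected) (hn : 3 ≤ Fintype.card V) (f : V → ℚ) :
    ∑ x ∈ Finset.univ.filter (fun x => G.degree x = 1), ∑ y ∈ G.neighborFinset x, f y =
      ∑ y ∈ Finset.univ.filter (fun y => 2 ≤ G.degree y), (numLeavesAt G y : ℚ) * f y := by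
  have hcomm := Finset.sum_comm' (f := fun _ y => f y)
    (s := Finset.univ.filter (fun x => G.degree x = 1)) (t := fun x => G.neighborFinset x)
    (t' := Finset.univ.filter (fun y => 2 ≤ G.degree y))
    (s' := fun y => (G.neighborFinset y).filter (fun u => G.degree u = 1)) ?_
  · rw [hcomm]
    simp [numLeavesAt]
  · intro x y
    simp only [Finset.mem_filter, Finset.mem_univ, true_and, mem_neighborFinset]
    constructor
    · rintro ⟨hx, hxy⟩
      refine ⟨⟨hxy.symm, hx⟩, ?_⟩
      have hpos : 0 < G.degree y := (G.degree_pos_iff_exists_adj y).2 ⟨x, hxy.symm⟩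
      have hne : G.degree y ≠ 1 := fun hy => by
        have := hG.card_le_two hxy hx hy
        omega
      omega
    · rintro ⟨⟨hyx, hx⟩, -⟩
      exact ⟨hx, hyx.symm⟩

end Counting

/-- If `T ∈ 𝒯₃` has `n ≥ 4` vertices and `t` twigs then `μ(T) < 3n/4 - 2t/5`. -/
theorem mu_lt_of_twigs {V : Type*} [Fintype V] (G : SimpleGraph V) (h : InT3 G)
    (hn : 4 ≤ Fintype.card V) :
    mu G < 3 * (Fintype.card V : ℚ) / 4 - 2 * (numTwigs G : ℚ) / 5 := by
  obtain ⟨hT, ⟨v₀, hv₀⟩, h3⟩ := h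
  have hG := hT.connected
  have : Nontrivial V := Fintype.one_lt_card_iff_nontrivial.1 (by omega)
  set R := (Finset.univ : Finset V).filter (fun v => 2 ≤ G.degree v) with hR
  set L := (Finset.univ : Finset V).filter (fun v => G.degree v = 1) with hL
  have hLR : (Finset.univ : Finset V).filter (fun v => ¬ 2 ≤ G.degree v) = L := by
    refine Finset.filter_congr fun v _ => ?_
    have := hG.preconnected.degree_pos_of_nontrivial v
    omega
  have split : ∀ f : V → ℚ, ∑ v, f v = ∑ v ∈ R, f v + ∑ v ∈ L, f v := fun f => by
    rw [← hLR, hR, Finset.sum_filter_add_sum_filter_not]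
  have hcard : (Fintype.card V : ℚ) = R.card + L.card := by
    have := split fun _ => 1
    simpa using this
  have hedge := hT.card_edgeFinset
  have hdegsum : ∑ v ∈ R, (G.degree v : ℚ) + L.card = 2 * (R.card + L.card) - 2 := by
    have h1 : (∑ v, (G.degree v : ℚ)) = 2 * G.edgeFinset.card := by
      exact_mod_cast G.sum_degrees_eq_twice_card_edges
    have h2 : ∑ v ∈ L, (G.degree v : ℚ) = L.card := by
      rw [Finset.sum_congr rfl (g := fun _ => (1 : ℚ)) fun v hv => by
        simp [(Finset.mem_filter.1 hv).2]]
      simp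
    have h3 : (G.edgeFinset.card : ℚ) + 1 = Fintype.card V := by exact_mod_cast hedge
    rw [split, h2] at h1
    linarith
  have hleaf := sum_leaf_neighbors hG (by omega)
  have hleafcard : ∑ v ∈ R, (numLeavesAt G v : ℚ) = L.card := by
    have h1 := hleaf fun _ => 1
    rw [Finset.sum_congr rfl (g := fun _ => (1 : ℚ)) fun x hx => by
      simp [(Finset.mem_filter.1 hx).2]] at h1
    simpa using h1.symm
  have hleafsum : ∑ v ∈ L, (numSubtreesAt G v : ℚ) ≤
      L.card + ∑ v ∈ R, (numLeavesAt G v : ℚ) * ((numSubtreesAt G v : ℚ) / 2) := by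
    rw [hR, ← hleaf, ← hL]
    have : (L.card : ℚ) = ∑ v ∈ L, 1 := by simp
    rw [this, ← Finset.sum_add_distrib]
    refine Finset.sum_le_sum fun x hx => ?_
    have hx : G.degree x = 1 := (Finset.mem_filter.1 hx).2
    obtain ⟨y, hy⟩ := Finset.card_eq_one.1 ((G.card_neighborFinset_eq_degree x).trans hx)
    rw [hy, Finset.sum_singleton]
    have hxy : G.Adj x y := by
      rw [← mem_neighborFinset, hy, Finset.mem_singleton]
    have : (2 : ℚ) * numSubtreesAt G x ≤ 2 + numSubtreesAt G y := by
      exact_mod_cast numSubtreesAt_leaf hx hxy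
    linarith
  set N : ℚ := ((subtreeFinset G).card : ℚ) with hN
  have hLN : (L.card : ℚ) < N / 2 := by
    have h1 := card_add_card_edgeFinset_le G
    have h2 : L.card < Fintype.card V := by
      refine Finset.card_lt_univ_of_notMem (x := v₀) fun hv => ?_
      have := (Finset.mem_filter.1 hv).2
      omega
    have h3 : 2 * L.card + 1 ≤ (subtreeFinset G).card := by omega
    have h3 : (2 : ℚ) * L.card + 1 ≤ N := by
      rw [hN]
      exact_mod_cast h3
    linarith
  have hNpos : 0 < N := by
    have : (0 : ℚ) ≤ L.card := by positivity
    linarith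
  have hinternal : ∑ v ∈ R, (numSubtreesAt G v : ℚ) * (1 + (numLeavesAt G v : ℚ) / 2) ≤
      ∑ v ∈ R, N * (1 + (numLeavesAt G v : ℚ) / 2 + ((G.degree v : ℚ) - 3) / 4 -
        2 / 5 * if IsTwig G v then 1 else 0) := by
    refine Finset.sum_le_sum fun v hv => ?_
    have hdeg := h3 v (Finset.mem_filter.1 hv).2
    by_cases ht : IsTwig G v
    · simpa [ht] using numSubtreesAt_twig ht hdeg
    · rw [if_neg ht]
      have hc : (numSubtreesAt G v : ℚ) ≤ N := by
        rw [hN]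
        exact_mod_cast Finset.card_filter_le _ _
      have hdegq : (3 : ℚ) ≤ G.degree v := by exact_mod_cast hdeg
      have hl : (0 : ℚ) ≤ numLeavesAt G v := by positivity
      refine mul_le_mul hc (by linarith) (by positivity) hNpos.le
  have htwigs : ∑ v ∈ R, (if IsTwig G v then (1 : ℚ) else 0) = numTwigs G := by
    rw [Finset.sum_boole, numTwigs, hR, Finset.filter_filter]
    congr 2
    exact Finset.filter_congr fun v _ => ⟨fun hv => hv.2, fun hv => ⟨hv.1, hv⟩⟩
  have hright : ∑ v ∈ R, N * (1 + (numLeavesAt G v : ℚ) / 2 + ((G.degree v : ℚ) - 3) / 4 -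
        2 / 5 * if IsTwig G v then 1 else 0) =
      N * (3 * (Fintype.card V : ℚ) / 4 - 2 * (numTwigs G : ℚ) / 5 - 1 / 2) := by
    rw [← Finset.mul_sum]
    congr 1
    rw [Finset.sum_sub_distrib, ← Finset.mul_sum, htwigs, Finset.sum_add_distrib,
      Finset.sum_add_distrib, ← Finset.sum_div, ← Finset.sum_div, Finset.sum_sub_distrib,
      hleafcard, hcard]
    simp only [Finset.sum_const, nsmul_eq_mul]
    linarith
  have hleft : ∑ v ∈ R, (numSubtreesAt G v : ℚ) * (1 + (numLeavesAt G v : ℚ) / 2) =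
      ∑ v ∈ R, (numSubtreesAt G v : ℚ) +
        ∑ v ∈ R, (numLeavesAt G v : ℚ) * ((numSubtreesAt G v : ℚ) / 2) := by
    rw [← Finset.sum_add_distrib]
    exact Finset.sum_congr rfl fun v _ => by ring
  have htotal : ∑ s ∈ subtreeFinset G, (s.card : ℚ) = ∑ v, (numSubtreesAt G v : ℚ) := by
    exact_mod_cast sum_card_subtrees G
  rw [mu, ← hN, div_lt_iff₀ hNpos, htotal, split]
  rw [hright, hleft] at hinternal
  linarith
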